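/- arXiv:1809.00738 — 2 statements merged into one kernel-verified Lean document; each statement's English description precedes it below -/
import Mathlib

section
/- A strong monoidal functor F : C → D between symmetric monoidal categories, with structure isomorphisms φ_{M,A} : FM ⊗ FA → F(M⊗A) and φ_I : I → FI, induces a functor Optic(F) : Optic_C → Optic_D given on objects by Optic(F)(S,S') = (FS, FS') and on morphisms by Optic(F)(⟨l|r⟩) := ⟨φ⁻¹_{M,A}∘(Fl) | (Fr)∘φ_{M,A'}⟩; this assignment is well defined on equivalence classes, preserves identities, and preserves composition. -/
/-!
STATEMENT 5: A strong monoidal functor `F : C → D` between symmetric monoidal categories,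
with structure isomorphisms `φ_{M,A} : FM ⊗ FA → F(M⊗A)` and `φ_I : I → FI`, induces a
functor `Optic(F) : Optic_C → Optic_D` given on objects by `Optic(F)(S,S') = (FS, FS')`
and on morphisms by `Optic(F)(⟨l|r⟩) := ⟨φ⁻¹_{M,A}∘(Fl) | (Fr)∘φ_{M,A'}⟩`; this assignment
is well defined on equivalence classes, preserves identities, and preserves composition.
-/

open CategoryTheory MonoidalCategory Functor.LaxMonoidal Functor.OplaxMonoidal

universe v₁ v₂ u₁ u₂

section OpticDefs

variable (C : Type u₁) [Category.{v₁} C] [MonoidalCategory C]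

structure OpticRep (S S' A A' : C) : Type max u₁ v₁ where
  m : C
  l : S ⟶ m ⊗ A
  r : m ⊗ A' ⟶ S'

variable {C}

inductive OpticRel {S S' A A' : C} : OpticRep C S S' A A' → OpticRep C S S' A A' → Prop
  | slide {m n : C} (f : m ⟶ n) (l : S ⟶ m ⊗ A) (r : n ⊗ A' ⟶ S') :
      OpticRel ⟨n, l ≫ (f ▷ A), r⟩ ⟨m, l, (f ▷ A') ≫ r⟩

def Optic {C : Type u₁} [Category.{v₁} C] [MonoidalCategory C] (S S' A A' : C) :
    Type max u₁ v₁ :=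
  Quot (@OpticRel C _ _ S S' A A')

def Optic.mk {S S' A A' : C} (p : OpticRep C S S' A A') : Optic S S' A A' :=
  Quot.mk _ p

/-- Composition of representatives: `⟨l|r⟩ ∘ ⟨l'|r'⟩ := ⟨(M'⊗l)∘l' | r'∘(M'⊗r)⟩`. -/
def compRep {R R' S S' A A' : C} (q : OpticRep C S S' A A') (p : OpticRep C R R' S S') :
    OpticRep C R R' A A' where
  m := p.m ⊗ q.m
  l := p.l ≫ (p.m ◁ q.l) ≫ (α_ p.m q.m A).inv
  r := (α_ p.m q.m A').hom ≫ (p.m ◁ q.r) ≫ p.r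

/-- The identity optic `⟨λ_S⁻¹ | λ_{S'}⟩`. -/
def idRep (S S' : C) : OpticRep C S S' S S' where
  m := 𝟙_ C
  l := (λ_ S).inv
  r := (λ_ S').hom

end OpticDefs

variable {C : Type u₁} [Category.{v₁} C] [MonoidalCategory C]
variable {D : Type u₂} [Category.{v₂} D] [MonoidalCategory D]

/-- The action of a strong monoidal functor `F` on a representative:
`⟨l | r⟩ ↦ ⟨φ⁻¹_{M,A} ∘ (Fl) | (Fr) ∘ φ_{M,A'}⟩`, where `φ = μ F` is the structure
isomorphism of `F` (and `δ F` its inverse). -/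
def mapRep (F : C ⥤ D) [F.Monoidal] {S S' A A' : C} (p : OpticRep C S S' A A') :
    OpticRep D (F.obj S) (F.obj S') (F.obj A) (F.obj A') where
  m := F.obj p.m
  l := F.map p.l ≫ δ F p.m A
  r := μ F p.m A' ≫ F.map p.r

theorem Optic.mk_eq_of_slide {S S' A A' : C} (p q : OpticRep C S S' A A') (f : q.m ⟶ p.m)
    (hl : p.l = q.l ≫ f ▷ A) (hr : q.r = f ▷ A' ≫ p.r) :
    (Optic.mk p : Optic S S' A A') = Optic.mk q := by
  obtain ⟨m, l, r⟩ := p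
  obtain ⟨n, l', r'⟩ := q
  dsimp only at f hl hr
  subst hl hr
  exact Quot.sound (OpticRel.slide f l' r)

/-- A strong (symmetric) monoidal functor `F : C ⥤ D` induces a functor
`Optic(F) : Optic_C ⥤ Optic_D`, given on objects by `(S,S') ↦ (FS,FS')` and computed on
representatives by `mapRep` (in particular that formula is well defined on equivalence
classes); it preserves the identity optics and preserves composition of optics. -/
theorem optic_map_functor [SymmetricCategory C] [SymmetricCategory D]
    (F : C ⥤ D) [F.Monoidal] :
    ∃ Fopt : ∀ (S S' A A' : C),
        Optic S S' A A' → Optic (F.obj S) (F.obj S') (F.obj A) (F.obj A'),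
      -- computed on representatives by `mapRep` (well-definedness)
      (∀ (S S' A A' : C) (p : OpticRep C S S' A A'),
          Fopt S S' A A' (Optic.mk p) = Optic.mk (mapRep F p)) ∧
      -- preserves identities
      (∀ S S' : C,
          Optic.mk (mapRep F (idRep S S')) =
            (Optic.mk (idRep (F.obj S) (F.obj S')) :
              Optic (F.obj S) (F.obj S') (F.obj S) (F.obj S'))) ∧
      -- preserves composition
      (∀ (R R' S S' A A' : C) (q : OpticRep C S S' A A') (p : OpticRep C R R' S S'),
          Optic.mk (mapRep F (compRep q p)) =
            Optic.mk (compRep (mapRep F q) (mapRep F p))) := by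
  refine ⟨fun S S' A A' => Quot.lift (fun p => Optic.mk (mapRep F p)) ?_, ?_, ?_, ?_⟩
  · rintro _ _ ⟨f, l, r⟩
    refine Optic.mk_eq_of_slide _ _ (F.map f) ?_ ?_
    · simp [mapRep]
    · simp [mapRep]
  · intro S S' A A' p
    rfl
  · intro S S'
    refine Optic.mk_eq_of_slide _ _ (ε F) ?_ ?_
    · simp only [mapRep, idRep, Functor.Monoidal.map_leftUnitor_inv, Category.assoc,
        Functor.Monoidal.μ_δ, Category.comp_id]
    · simp [mapRep, idRep]
  · intro R R' S S' A A' q p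
    refine Optic.mk_eq_of_slide _ _ (μ F p.m q.m) ?_ ?_
    · simp only [mapRep, compRep, Functor.Monoidal.map_associator_inv, Functor.Monoidal.map_whiskerLeft,
        Category.assoc, Functor.map_comp, comp_whiskerRight, whiskerLeft_comp, Category.comp_id, Category.id_comp,
        Functor.Monoidal.μ_δ, Functor.Monoidal.δ_μ, Functor.Monoidal.μ_δ_assoc, Functor.Monoidal.δ_μ_assoc]
    · simp only [mapRep, compRep, Functor.Monoidal.map_associator, Functor.Monoidal.map_whiskerLeft,
        Category.assoc, Functor.map_comp, comp_whiskerRight, whiskerLeft_comp, Category.comp_id, Category.id_comp,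
        Functor.Monoidal.μ_δ, Functor.Monoidal.δ_μ, Functor.Monoidal.μ_δ_assoc, Functor.Monoidal.δ_μ_assoc]
      rw [← comp_whiskerRight_assoc, Functor.Monoidal.μ_δ, id_whiskerRight, Category.id_comp]
end

section
/- Let C be a category with finite products. A concrete lens given by Get : S → A and Put : S×A → S is lawful as an optic (i.e. the optic ⟨[id_S, Get] | Put⟩ : S ⇸ A satisfies outside = id and once = twice) if and only if it obeys the three concrete lens laws: (GetPut) Put ∘ [id_S, Get] = id_S; (PutGet) Get ∘ Put = π₂; (PutPut) Put ∘ (Put × id_A) = Put ∘ π_{1,3} as maps S×A×A → S. -/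
/-!
STATEMENT 12: Let `C` be a category with finite products. A concrete lens given by
`Get : S → A` and `Put : S×A → S` is lawful as an optic (i.e. the optic
`⟨[id_S, Get] | Put⟩ : S ⇸ A` satisfies `outside = id` and `once = twice`) if and only if
it obeys the three concrete lens laws: (GetPut) `Put ∘ [id_S, Get] = id_S`;
(PutGet) `Get ∘ Put = π₂`; (PutPut) `Put ∘ (Put × id_A) = Put ∘ π_{1,3}` as maps
`S×A×A → S`.
-/

open CategoryTheory Limits

universe v u

variable (C : Type u) [Category.{v} C] [HasFiniteProducts C]

/-- A representative of an optic `(S,S) ⇸ (A,A)` for the cartesian monoidal structure. -/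
structure LensOpticRep (S A : C) : Type max u v where
  m : C
  l : S ⟶ m ⨯ A
  r : m ⨯ A ⟶ S

/-- A representative of an element of
`Optic²(S,A) = ∫^{M₁,M₂} C(S, M₁×A) × C(M₁×A, M₂×A) × C(M₂×A, S)`. -/
structure LensOptic2Rep (S A : C) : Type max u v where
  m₁ : C
  m₂ : C
  l : S ⟶ m₁ ⨯ A
  c : m₁ ⨯ A ⟶ m₂ ⨯ A
  r : m₂ ⨯ A ⟶ S

variable {C}

/-- The coend relation `⟨(f×A)∘l | r⟩ ∼ ⟨l | r∘(f×A)⟩`. -/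
inductive LensOpticRel {S A : C} : LensOpticRep C S A → LensOpticRep C S A → Prop
  | slide {m n : C} (f : m ⟶ n) (l : S ⟶ m ⨯ A) (r : n ⨯ A ⟶ S) :
      LensOpticRel ⟨n, l ≫ prod.map f (𝟙 A), r⟩ ⟨m, l, prod.map f (𝟙 A) ≫ r⟩

/-- The coend relations for `Optic²(S,A)`, sliding morphisms of `C` across each of the
two cut points. -/
inductive LensOptic2Rel {S A : C} : LensOptic2Rep C S A → LensOptic2Rep C S A → Prop
  | slideL {m₁ n₁ m₂ : C} (f : m₁ ⟶ n₁) (l : S ⟶ m₁ ⨯ A) (c : n₁ ⨯ A ⟶ m₂ ⨯ A)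
      (r : m₂ ⨯ A ⟶ S) :
      LensOptic2Rel ⟨n₁, m₂, l ≫ prod.map f (𝟙 A), c, r⟩
        ⟨m₁, m₂, l, prod.map f (𝟙 A) ≫ c, r⟩
  | slideR {m₁ m₂ n₂ : C} (g : m₂ ⟶ n₂) (l : S ⟶ m₁ ⨯ A) (c : m₁ ⨯ A ⟶ m₂ ⨯ A)
      (r : n₂ ⨯ A ⟶ S) :
      LensOptic2Rel ⟨m₁, n₂, l, c ≫ prod.map g (𝟙 A), r⟩
        ⟨m₁, m₂, l, c, prod.map g (𝟙 A) ≫ r⟩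

/-- The set of optics `S ⇸ A` (an abbreviation for `(S,S) ⇸ (A,A)`). -/
def LensOptic (S A : C) : Type max u v :=
  Quot (@LensOpticRel C _ _ S A)

def LensOptic2 (S A : C) : Type max u v :=
  Quot (@LensOptic2Rel C _ _ S A)

/-- `once(⟨l|r⟩) = ⟨l | id | r⟩`. -/
noncomputable def onceRep {S A : C} (p : LensOpticRep C S A) : LensOptic2 S A :=
  Quot.mk _ ⟨p.m, p.m, p.l, 𝟙 (p.m ⨯ A), p.r⟩

/-- `twice(⟨l|r⟩) = ⟨l | l∘r | r⟩`. -/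
noncomputable def twiceRep {S A : C} (p : LensOpticRep C S A) : LensOptic2 S A :=
  Quot.mk _ ⟨p.m, p.m, p.l, p.r ≫ p.l, p.r⟩

/-- An optic `p : S ⇸ A` is lawful if `outside(p) = id_S` and `once(p) = twice(p)`.
(Both `outside` and `once`/`twice` are well defined on equivalence classes, so this may be
phrased over all representatives of `p`.) -/
def LensOptic.Lawful {S A : C} (p : LensOptic S A) : Prop :=
  ∀ rep : LensOpticRep C S A, Quot.mk _ rep = p →
    rep.l ≫ rep.r = 𝟙 S ∧ onceRep rep = twiceRep rep

/-- `once` respects the coend relation. -/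
theorem onceRep_rel {S A : C} (p q : LensOpticRep C S A) (h : LensOpticRel p q) :
    onceRep p = onceRep q := by
  obtain ⟨f, l, r⟩ := h
  have h1 := Quot.sound (LensOptic2Rel.slideL f l (𝟙 _) r)
  have h2 := Quot.sound (LensOptic2Rel.slideR f l (𝟙 _) r)
  rw [Category.comp_id] at h1
  rw [Category.id_comp] at h2
  exact h1.trans h2

/-- `twice` respects the coend relation. -/
theorem twiceRep_rel {S A : C} (p q : LensOpticRep C S A) (h : LensOpticRel p q) :
    twiceRep p = twiceRep q := by
  obtain ⟨f, l, r⟩ := h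
  have h1 := Quot.sound (LensOptic2Rel.slideL f l (r ≫ l ≫ prod.map f (𝟙 A)) r)
  have h2 := Quot.sound (LensOptic2Rel.slideR f l ((prod.map f (𝟙 A) ≫ r) ≫ l) r)
  simp only [Category.assoc] at h1 h2
  unfold twiceRep
  simp only [Category.assoc]
  exact h1.trans h2

/-- `outside` respects the coend relation. -/
theorem outside_rel {S A : C} (p q : LensOpticRep C S A) (h : LensOpticRel p q) :
    p.l ≫ p.r = q.l ≫ q.r := by
  obtain ⟨f, l, r⟩ := h
  simp

/-- The concrete invariants of a representative of `Optic²`. -/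
noncomputable def optic2Inv {S A : C} (p : LensOptic2Rep C S A) :
    (S ⨯ A ⟶ A) × ((S ⨯ A) ⨯ A ⟶ S) :=
  (prod.map (p.l ≫ prod.fst) (𝟙 A) ≫ p.c ≫ prod.snd,
   prod.map (prod.map (p.l ≫ prod.fst) (𝟙 A) ≫ p.c ≫ prod.fst) (𝟙 A) ≫ p.r)

theorem optic2Inv_rel {S A : C} (p q : LensOptic2Rep C S A) (h : LensOptic2Rel p q) :
    optic2Inv p = optic2Inv q := by
  have key : ∀ {X Y Z : C} (a : X ⟶ Y) (b : Y ⟶ Z),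
      prod.map (a ≫ b) (𝟙 A) = prod.map a (𝟙 A) ≫ prod.map b (𝟙 A) := by
    intros; simp
  cases h with
  | slideL f l c r =>
    simp only [optic2Inv, Category.assoc, prod.map_fst, key]
  | slideR g l c r =>
    simp only [optic2Inv, Category.assoc, prod.map_fst, prod.map_snd, Category.comp_id, key]

/-- **Statement 12.** A concrete lens `(Get, Put)` is lawful as an optic iff it satisfies
the three concrete lens laws `GetPut`, `PutGet` and `PutPut`
(`π_{1,3} = π₁ × id_A : (S ⨯ A) ⨯ A ⟶ S ⨯ A`). -/
theorem lens_lawful_iff_lens_laws (C : Type u) [Category.{v} C] [HasFiniteProducts C]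
    {S A : C} (Get : S ⟶ A) (Put : S ⨯ A ⟶ S) :
    LensOptic.Lawful (Quot.mk _ ⟨S, prod.lift (𝟙 S) Get, Put⟩ : LensOptic S A) ↔
      (prod.lift (𝟙 S) Get ≫ Put = 𝟙 S ∧
       Put ≫ Get = prod.snd ∧
       prod.map Put (𝟙 A) ≫ Put = prod.map prod.fst (𝟙 A) ≫ Put) := by
  constructor
  · intro h
    obtain ⟨h1, h2⟩ := h _ rfl
    have h3 := congrArg (Quot.lift optic2Inv optic2Inv_rel) h2
    have h4 : prod.map (prod.lift (𝟙 S) Get ≫ prod.fst) (𝟙 A) ≫ 𝟙 (S ⨯ A) ≫ prod.snd =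
        prod.map (prod.lift (𝟙 S) Get ≫ prod.fst) (𝟙 A) ≫
          (Put ≫ prod.lift (𝟙 S) Get) ≫ prod.snd := congrArg Prod.fst h3
    have h5 : prod.map (prod.map (prod.lift (𝟙 S) Get ≫ prod.fst) (𝟙 A) ≫
          𝟙 (S ⨯ A) ≫ prod.fst) (𝟙 A) ≫ Put =
        prod.map (prod.map (prod.lift (𝟙 S) Get ≫ prod.fst) (𝟙 A) ≫
          (Put ≫ prod.lift (𝟙 S) Get) ≫ prod.fst) (𝟙 A) ≫ Put := congrArg Prod.snd h3
    refine ⟨h1, ?_, ?_⟩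
    · simpa [prod.lift_fst, prod.lift_snd] using h4.symm
    · simpa [prod.lift_fst, prod.lift_snd] using h5.symm
  · rintro ⟨h1, h2, h3⟩ rep hrep
    have ho := congrArg (Quot.lift (fun p : LensOpticRep C S A => p.l ≫ p.r) outside_rel) hrep
    have hon := congrArg (Quot.lift onceRep onceRep_rel) hrep
    have htw := congrArg (Quot.lift twiceRep twiceRep_rel) hrep
    refine ⟨ho.trans h1, hon.trans (Eq.trans ?_ htw.symm)⟩
    have e1 := Quot.sound (LensOptic2Rel.slideR Put (prod.lift (𝟙 S) Get)
      (prod.lift (𝟙 (S ⨯ A)) prod.snd) Put)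
    have e2 := Quot.sound (LensOptic2Rel.slideR prod.fst (prod.lift (𝟙 S) Get)
      (prod.lift (𝟙 (S ⨯ A)) prod.snd) Put)
    have c1 : prod.lift (𝟙 (S ⨯ A)) prod.snd ≫ prod.map Put (𝟙 A)
        = Put ≫ prod.lift (𝟙 S) Get := by
      ext <;> simp [h2]
    have c2 : prod.lift (𝟙 (S ⨯ A)) prod.snd ≫ prod.map prod.fst (𝟙 A)
        = 𝟙 (S ⨯ A) := by
      ext <;> simp
    rw [c1, h3] at e1
    rw [c2] at e2
    exact e2.trans e1.symm
end
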